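/- Let k and a be integers with 1 ≤ a ≤ k, k odd, and a even. For a nonnegative integer n, let OW_{k,a}(n) denote the number of partitions λ of n such that f_1(λ) ≤ a−1, f_i(λ)+f_{i+1}(λ) ≤ k−1 for every i ≥ 1, and every odd part appears an even number of times (i.e., f_{2j−1}(λ) is even for all j ≥ 1). Then for every complex number q with |q| < 1, ∑_{n ≥ 0} OW_{k,a}(n) q^n = (−q²; q²)_∞ (q^a, q^{2k+2−a}, q^{2k+2}; q^{2k+2})_∞ / (q²; q²)_∞. -/

import Mathlib

open Finset

/-- Finite q-Pochhammer symbol `(x;q)_n`. -/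
noncomputable def qPoch (q x : ℂ) (n : ℕ) : ℂ :=
  ∏ j ∈ Finset.range n, (1 - x * q ^ j)

/-- Infinite q-Pochhammer symbol `(x;q)_∞`. -/
noncomputable def qPochInf (q x : ℂ) : ℂ :=
  ∏' j : ℕ, (1 - x * q ^ j)

open Filter Topology

lemma summable_norm_mul_pow {q : ℂ} (hq : ‖q‖ < 1) (x : ℂ) :
    Summable fun j : ℕ => ‖-(x * q ^ j)‖ := by
  simpa using (summable_geometric_of_lt_one (norm_nonneg q) hq).mul_left ‖x‖

lemma one_sub_mul_pow_ne_zero {q x : ℂ} (hq : ‖q‖ < 1) (hx : ‖x‖ < 1) (j : ℕ) :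
    1 - x * q ^ j ≠ 0 := by
  have h : ‖x * q ^ j‖ < 1 := by
    rw [norm_mul, norm_pow]
    exact (mul_le_of_le_one_right (norm_nonneg x)
      (pow_le_one₀ (norm_nonneg q) hq.le)).trans_lt hx
  intro h0
  rw [← sub_eq_zero.mp h0, norm_one] at h
  exact lt_irrefl _ h

lemma tendsto_qPoch {q : ℂ} (hq : ‖q‖ < 1) (x : ℂ) :
    Tendsto (qPoch q x) atTop (𝓝 (qPochInf q x)) := by
  have h := (multipliable_one_add_of_summable (summable_norm_mul_pow hq x)).hasProd.tendsto_prod_nat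
  simp only [← sub_eq_add_neg] at h
  exact h

lemma qPochInf_ne_zero {q x : ℂ} (hq : ‖q‖ < 1) (hx : ‖x‖ < 1) : qPochInf q x ≠ 0 := by
  have h := tprod_one_add_ne_zero_of_summable (f := fun j : ℕ => -(x * q ^ j))
    (fun j => by simpa only [← sub_eq_add_neg] using one_sub_mul_pow_ne_zero hq hx j)
    (summable_norm_mul_pow hq x)
  simp only [← sub_eq_add_neg] at h
  exact h

lemma qPoch_ne_zero {q x : ℂ} (hq : ‖q‖ < 1) (hx : ‖x‖ < 1) (n : ℕ) : qPoch q x n ≠ 0 :=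
  Finset.prod_ne_zero_iff.mpr fun j _ => one_sub_mul_pow_ne_zero hq hx j

lemma qPoch_succ (q x : ℂ) (n : ℕ) : qPoch q x (n + 1) = qPoch q x n * (1 - x * q ^ n) :=
  Finset.prod_range_succ _ _

/-- The inverses of a sequence with nonzero limit are bounded. -/
lemma exists_norm_inv_le_of_tendsto {u : ℕ → ℂ} {l : ℂ} (hu : Tendsto u atTop (𝓝 l))
    (hl : l ≠ 0) : ∃ C, ∀ n, ‖(u n)⁻¹‖ ≤ C := by
  obtain ⟨C, hC⟩ := (hu.inv₀ hl).norm.bddAbove_range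
  exact ⟨C, fun n => hC ⟨n, rfl⟩⟩

lemma exists_norm_le_of_tendsto {u : ℕ → ℂ} {l : ℂ} (hu : Tendsto u atTop (𝓝 l)) :
    ∃ C, ∀ n, ‖u n‖ ≤ C := by
  obtain ⟨C, hC⟩ := hu.norm.bddAbove_range
  exact ⟨C, fun n => hC ⟨n, rfl⟩⟩

/-- The Gaussian binomial coefficient. -/
def gaussBinom (q : ℂ) : ℕ → ℕ → ℂ
  | _, 0 => 1
  | 0, _ + 1 => 0
  | n + 1, j + 1 => gaussBinom q n j + q ^ (j + 1) * gaussBinom q n (j + 1)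

lemma gaussBinom_zero_right (q : ℂ) (n : ℕ) : gaussBinom q n 0 = 1 := by
  cases n <;> rfl

lemma gaussBinom_eq_zero (q : ℂ) {n j : ℕ} (h : n < j) : gaussBinom q n j = 0 := by
  induction n generalizing j with
  | zero => obtain ⟨j, rfl⟩ := Nat.exists_eq_add_of_lt h; simp [gaussBinom]
  | succ n ih =>
    obtain ⟨j, rfl⟩ := Nat.exists_eq_succ_of_ne_zero (by omega : j ≠ 0)
    simp [gaussBinom, ih (show n < j by omega), ih (show n < j + 1 by omega)]

lemma gaussBinom_self (q : ℂ) (n : ℕ) : gaussBinom q n n = 1 := by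
  induction n with
  | zero => rfl
  | succ n ih => simp [gaussBinom, ih, gaussBinom_eq_zero]

lemma gaussBinom_mul_qPoch (q : ℂ) (i j : ℕ) :
    gaussBinom q (i + j) j * qPoch q q i * qPoch q q j = qPoch q q (i + j) := by
  induction i generalizing j with
  | zero => simp [gaussBinom_self, qPoch]
  | succ i ih =>
    induction j with
    | zero => simp [gaussBinom_zero_right, qPoch]
    | succ j ihj =>
      have h1 := ih (j + 1)
      rw [show i + 1 + (j + 1) = (i + 1 + j) + 1 by ring, gaussBinom]
      rw [show i + (j + 1) = i + 1 + j by ring] at h1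
      rw [qPoch_succ q q (i + 1 + j)]
      rw [add_mul, add_mul, qPoch_succ q q j, qPoch_succ q q i]
      rw [qPoch_succ q q j] at h1
      rw [qPoch_succ q q i] at ihj
      linear_combination (1 - q * q ^ j) * ihj + q ^ (j + 1) * (1 - q * q ^ i) * h1

/-- The homogeneous `q`-binomial theorem. -/
lemma prod_sub_mul_pow_eq_sum (q u w : ℂ) (n : ℕ) :
    ∏ j ∈ range n, (u - w * q ^ j) = ∑ j ∈ range (n + 1),
      (-1) ^ j * q ^ j.choose 2 * w ^ j * u ^ (n - j) * gaussBinom q n j := by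
  induction n generalizing w with
  | zero => simp [gaussBinom]
  | succ n ih =>
    rw [prod_range_succ']
    have h : ∏ j ∈ range n, (u - w * q ^ (j + 1)) = ∏ j ∈ range n, (u - (w * q) * q ^ j) :=
      prod_congr rfl fun j _ => by ring
    rw [h, ih, sum_range_succ' _ (n + 1), pow_zero, mul_one, mul_sub, sum_mul, sum_mul,
      sum_range_succ' (fun j => _ * u)]
    have hlast : ∑ j ∈ range n, (-1) ^ (j + 1) * q ^ (j + 1).choose 2 * (w * q) ^ (j + 1) *
        u ^ (n - (j + 1)) * gaussBinom q n (j + 1) * u = ∑ j ∈ range (n + 1),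
        (-1) ^ (j + 1) * q ^ (j + 1).choose 2 * (w * q) ^ (j + 1) *
        u ^ (n - j) * gaussBinom q n (j + 1) := by
      rw [sum_range_succ, gaussBinom_eq_zero q (Nat.lt_succ_self n), mul_zero, add_zero]
      refine sum_congr rfl fun j hj => ?_
      rw [show n - j = n - (j + 1) + 1 by have := mem_range.mp hj; omega]
      ring
    rw [hlast, add_sub_right_comm, ← sum_sub_distrib]
    congr 1
    · refine sum_congr rfl fun j _ => ?_
      rw [gaussBinom, Nat.choose_succ_succ' j 1, Nat.choose_one_right, Nat.succ_sub_succ]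
      ring
    · simp [gaussBinom_zero_right]; ring

lemma gaussBinom_add_eq_div {q : ℂ} (hq : ‖q‖ < 1) (i j : ℕ) :
    gaussBinom q (i + j) j = qPoch q q (i + j) * ((qPoch q q i)⁻¹ * (qPoch q q j)⁻¹) := by
  have hi := qPoch_ne_zero hq hq i
  have hj := qPoch_ne_zero hq hq j
  rw [← gaussBinom_mul_qPoch]
  field_simp

lemma gaussBinom_symm_add {q : ℂ} (hq : ‖q‖ < 1) (i j : ℕ) :
    gaussBinom q (i + j) j = gaussBinom q (i + j) i := by
  rw [gaussBinom_add_eq_div hq, add_comm i j, gaussBinom_add_eq_div hq]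
  ring

lemma choose_two_add (m n : ℕ) : (m + n).choose 2 = m.choose 2 + n.choose 2 + m * n := by
  induction n with
  | zero => simp
  | succ n ih =>
    rw [← add_assoc, Nat.choose_succ_succ' (m + n) 1, Nat.choose_succ_succ' n 1, ih]
    simp only [Nat.choose_one_right]
    ring

/-- The finite form of the Jacobi triple product identity. -/
lemma qPoch_mul_qPoch_eq_sum {x y q : ℂ} (hxy : x * y = q) (hq : ‖q‖ < 1) (hq0 : q ≠ 0) (N : ℕ) :
    qPoch q x N * qPoch q y N =
      ∑ s ∈ range (N + 1), (-1) ^ s * q ^ s.choose 2 * y ^ s * gaussBinom q (2 * N) (N + s) +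
      ∑ s ∈ range N, (-1) ^ (s + 1) * q ^ (s + 1).choose 2 * x ^ (s + 1) *
        gaussBinom q (2 * N) (N + (s + 1)) := by
  have hy : y ≠ 0 := fun h => hq0 (by rw [← hxy, h, mul_zero])
  have hc : (-y) ^ N * q ^ N.choose 2 * q ^ (N * N) ≠ 0 := by simp [hy, hq0]
  apply mul_left_cancel₀ hc
  have hlow : ∏ j ∈ range N, (q ^ N - y * q ^ j) = (-y) ^ N * q ^ N.choose 2 * qPoch q x N := by
    have h : ∀ j ∈ range N, q ^ N - y * q ^ (N - 1 - j) =
        (-y) * q ^ (N - 1 - j) * (1 - x * q ^ j) := by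
      intro j hj
      have hN : q ^ N = q ^ (N - 1 - j) * q ^ j * q := by
        rw [← pow_add, ← pow_succ]
        congr 1
        have := mem_range.mp hj
        omega
      rw [hN, ← hxy]
      ring
    rw [← prod_range_reflect, prod_congr rfl h, prod_mul_distrib, prod_mul_distrib, prod_const,
      card_range, prod_range_reflect (fun j => q ^ j), prod_pow_eq_pow_sum, sum_range_id,
      Nat.choose_two_right]
    rfl
  have hhigh : ∏ j ∈ range N, (q ^ N - y * q ^ (N + j)) = q ^ (N * N) * qPoch q y N := by
    have h : ∀ j ∈ range N, q ^ N - y * q ^ (N + j) = q ^ N * (1 - y * q ^ j) := by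
      intro j _
      ring
    rw [prod_congr rfl h, prod_mul_distrib, prod_const, card_range, ← pow_mul]
    rfl
  have hmain := prod_sub_mul_pow_eq_sum q (q ^ N) y (2 * N)
  rw [two_mul, prod_range_add, hlow, hhigh, ← two_mul, show 2 * N + 1 = N + (N + 1) by ring,
    sum_range_add, ← sum_range_reflect _ N] at hmain
  rw [show (-y) ^ N * q ^ N.choose 2 * q ^ (N * N) * (qPoch q x N * qPoch q y N) =
    (-y) ^ N * q ^ N.choose 2 * qPoch q x N * (q ^ (N * N) * qPoch q y N) by ring, hmain, mul_add,
    mul_sum, mul_sum, add_comm]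
  congr 1
  · refine sum_congr rfl fun s hs => ?_
    have hs' : s ≤ N := by have := mem_range.mp hs; omega
    obtain ⟨t, rfl⟩ := Nat.exists_eq_add_of_le hs'
    rw [show 2 * (s + t) - (s + t + s) = t by omega, choose_two_add (s + t) s, neg_pow y]
    ring
  · refine sum_congr rfl fun s hs => ?_
    have hs' : s + 1 ≤ N := by have := mem_range.mp hs; omega
    obtain ⟨t, rfl⟩ := Nat.exists_eq_add_of_le hs'
    rw [show s + 1 + t - 1 - s = t by omega,
      show 2 * (s + 1 + t) = (s + 1 + t + (s + 1)) + t by ring,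
      gaussBinom_symm_add hq, Nat.add_sub_cancel, choose_two_add (s + 1) t, neg_pow y]
    have h1 : ((-1 : ℂ)) ^ (s + 1 + t) * (-1) ^ (s + 1) = (-1) ^ t := by
      rw [← pow_add, show s + 1 + t + (s + 1) = 2 * (s + 1) + t by ring, pow_add, pow_mul]
      simp
    have h2 : y ^ (s + 1 + t) * x ^ (s + 1) = q ^ (s + 1) * y ^ t := by
      rw [← hxy]
      ring
    have h3 : (s + 1).choose 2 * 2 + (s + 1) = (s + 1) * (s + 1) := by
      rw [Nat.choose_two_right, Nat.div_mul_cancel (Nat.even_mul_pred_self _).two_dvd,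
        Nat.add_sub_cancel]
      ring
    calc (-1 : ℂ) ^ t * q ^ t.choose 2 * y ^ t * (q ^ (s + 1 + t)) ^ (s + 1 + t + (s + 1)) *
          gaussBinom q (s + 1 + t + (s + 1) + t) (s + 1 + t + (s + 1))
        = (-1 : ℂ) ^ t * y ^ t * q ^ (t.choose 2 + (s + 1 + t) * (s + 1 + t) + t * (s + 1)
          + (s + 1) * (s + 1)) *
          gaussBinom q (s + 1 + t + (s + 1) + t) (s + 1 + t + (s + 1)) := by ring
      _ = _ := by
        rw [← h1, ← h3]
        linear_combination (-(-1 : ℂ) ^ (s + 1 + t) * (-1) ^ (s + 1) *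
          q ^ (t.choose 2 + (s + 1 + t) * (s + 1 + t) + t * (s + 1) + (s + 1).choose 2 * 2) *
          gaussBinom q (s + 1 + t + (s + 1) + t) (s + 1 + t + (s + 1))) * h2

lemma tendsto_gaussBinom {q : ℂ} (hq : ‖q‖ < 1) (s : ℕ) :
    Tendsto (fun N => gaussBinom q (2 * N) (N + s)) atTop (𝓝 (qPochInf q q)⁻¹) := by
  have hD := tendsto_qPoch hq q
  have hne := qPochInf_ne_zero hq hq
  have h2 : Tendsto (fun N : ℕ => 2 * N) atTop atTop :=
    tendsto_id.const_mul_atTop' two_pos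
  have h := (hD.comp h2).mul (((hD.comp (tendsto_sub_atTop_nat s)).inv₀ hne).mul
    ((hD.comp (tendsto_add_atTop_nat s)).inv₀ hne))
  rw [mul_inv_cancel_left₀ hne] at h
  refine h.congr' ?_
  filter_upwards [eventually_ge_atTop s] with N hN
  have h' := gaussBinom_add_eq_div hq (N - s) (N + s)
  rw [show N - s + (N + s) = 2 * N by omega] at h'
  exact h'.symm

lemma exists_norm_gaussBinom_le {q : ℂ} (hq : ‖q‖ < 1) :
    ∃ C, 0 ≤ C ∧ ∀ n j, ‖gaussBinom q n j‖ ≤ C := by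
  obtain ⟨A, hA⟩ := exists_norm_le_of_tendsto (tendsto_qPoch hq q)
  obtain ⟨B, hB⟩ := exists_norm_inv_le_of_tendsto (tendsto_qPoch hq q) (qPochInf_ne_zero hq hq)
  have hA0 : 0 ≤ A := (norm_nonneg _).trans (hA 0)
  have hB0 : 0 ≤ B := (norm_nonneg _).trans (hB 0)
  refine ⟨A * (B * B), by positivity, fun n j => ?_⟩
  rcases lt_or_ge n j with h | h
  · rw [gaussBinom_eq_zero q h, norm_zero]
    positivity
  · obtain ⟨i, rfl⟩ := Nat.exists_eq_add_of_le' h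
    rw [gaussBinom_add_eq_div hq, norm_mul, norm_mul]
    gcongr
    exacts [hA _, hB _, hB _]

/-- The Jacobi triple product identity, with the terms of index `n` and `-n - 1` grouped. -/
lemma hasSum_jacobi_triple_product {x y q : ℂ} (hxy : x * y = q) (hq0 : q ≠ 0)
    (hx : ‖x‖ < 1) (hy : ‖y‖ < 1) :
    HasSum (fun n : ℕ => (-1) ^ n * q ^ n.choose 2 * y ^ n * (1 - x ^ (2 * n + 1)))
      (qPochInf q x * qPochInf q y * qPochInf q q) := by
  have hq : ‖q‖ < 1 := by
    rw [← hxy, norm_mul]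
    exact mul_lt_one_of_nonneg_of_lt_one_left (norm_nonneg x) hx hy.le
  have hne := qPochInf_ne_zero hq hq
  obtain ⟨C, hC0, hC⟩ := exists_norm_gaussBinom_le hq
  set u : ℕ → ℂ := fun s => (-1) ^ s * q ^ s.choose 2 * y ^ s with hu
  set v : ℕ → ℂ := fun s => (-1) ^ (s + 1) * q ^ (s + 1).choose 2 * x ^ (s + 1) with hv
  have hu_le : ∀ s, ‖u s‖ ≤ ‖y‖ ^ s := fun s => by
    simp only [hu, norm_mul, norm_pow, norm_neg, norm_one, one_pow, one_mul]
    exact mul_le_of_le_one_left (by positivity) (pow_le_one₀ (norm_nonneg q) hq.le)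
  have hv_le : ∀ s, ‖v s‖ ≤ ‖x‖ ^ s := fun s => by
    simp only [hv, norm_mul, norm_pow, norm_neg, norm_one, one_pow, one_mul]
    exact (mul_le_of_le_one_left (by positivity) (pow_le_one₀ (norm_nonneg q) hq.le)).trans
      (pow_le_pow_of_le_one (norm_nonneg x) hx.le (Nat.le_succ s))
  have hgeom : Summable fun s : ℕ => ‖y‖ ^ s + ‖x‖ ^ s :=
    (summable_geometric_of_lt_one (norm_nonneg y) hy).add
      (summable_geometric_of_lt_one (norm_nonneg x) hx)
  have huv : Summable fun s => u s + v s :=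
    Summable.of_norm_bounded hgeom fun s => (norm_add_le _ _).trans (add_le_add (hu_le s) (hv_le s))
  have hfin : ∀ N, ∑' s, (u s * gaussBinom q (2 * N) (N + s) +
      v s * gaussBinom q (2 * N) (N + (s + 1))) = qPoch q x N * qPoch q y N := by
    intro N
    rw [tsum_eq_sum (s := range (N + 1)), qPoch_mul_qPoch_eq_sum hxy hq hq0, sum_add_distrib]
    · congr 1
      rw [sum_range_succ, gaussBinom_eq_zero q (show 2 * N < N + (N + 1) by omega), mul_zero,
        add_zero]
    · intro s hs
      have hs' : N + 1 ≤ s := by simpa using hs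
      rw [gaussBinom_eq_zero q (by omega), gaussBinom_eq_zero q (by omega)]
      simp
  have hlim : Tendsto (fun N => ∑' s, (u s * gaussBinom q (2 * N) (N + s) +
      v s * gaussBinom q (2 * N) (N + (s + 1)))) atTop
      (𝓝 (∑' s, (u s * (qPochInf q q)⁻¹ + v s * (qPochInf q q)⁻¹))) := by
    refine tendsto_tsum_of_dominated_convergence (hgeom.mul_right C) (fun s => ?_)
      (Eventually.of_forall fun N s => ?_)
    · exact ((tendsto_gaussBinom hq s).const_mul _).add
        ((tendsto_gaussBinom hq (s + 1)).const_mul _)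
    · rw [add_mul]
      refine (norm_add_le _ _).trans (add_le_add ?_ ?_) <;> rw [norm_mul]
      · exact mul_le_mul (hu_le s) (hC _ _) (norm_nonneg _) (by positivity)
      · exact mul_le_mul (hv_le s) (hC _ _) (norm_nonneg _) (by positivity)
  simp only [hfin] at hlim
  have heq := tendsto_nhds_unique hlim ((tendsto_qPoch hq x).mul (tendsto_qPoch hq y))
  simp only [← add_mul] at heq
  rw [tsum_mul_right] at heq
  rw [← heq, inv_mul_cancel_right₀ hne]
  refine huv.hasSum.congr_fun fun n => ?_
  have hpow : y ^ n * x ^ (2 * n + 1) = q ^ n * x ^ (n + 1) := by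
    rw [← hxy]
    ring
  simp only [hu, hv, Nat.choose_succ_succ' n 1, Nat.choose_one_right]
  linear_combination -(-1) ^ n * q ^ n.choose 2 * hpow

/-- The ratio `(q²;q²)_{μ+n} / (q²;q²)_n`. -/
noncomputable def pochRatio (q : ℂ) (μ n : ℕ) : ℂ :=
  qPoch (q ^ 2) (q ^ 2) (μ + n) / qPoch (q ^ 2) (q ^ 2) n

/-- The terms of the series solving the Gordon-type recurrences. -/
noncomputable def gordonTerm (q : ℂ) (k μ a n : ℕ) : ℂ :=
  (-1) ^ n * q ^ ((2 * k + 2) * n.choose 2 + ((μ + 1) * k + (k + 2 - a)) * n) *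
    (1 - q ^ ((μ + 1 + 2 * n) * a)) * pochRatio q μ n

/-- Up to the factor `1 / (q²;q²)_∞` and with `z = q ^ (μ + 1)`, the series
`∑ (-1)^n z^{kn} q^{(k+1)n² + (1-a)n} (1 - z^a q^{2na}) / ((q²;q²)_n (z²q^{2n};q²)_∞)`. -/
noncomputable def gordonSum (q : ℂ) (k μ a : ℕ) : ℂ := ∑' n, gordonTerm q k μ a n

lemma norm_sq_lt_one {q : ℂ} (hq : ‖q‖ < 1) : ‖q ^ 2‖ < 1 := by
  rw [norm_pow]
  exact pow_lt_one₀ (norm_nonneg q) hq two_ne_zero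

lemma norm_one_sub_pow_le {q : ℂ} (hq : ‖q‖ < 1) (e : ℕ) : ‖1 - q ^ e‖ ≤ 2 := by
  have h : ‖q ^ e‖ ≤ 1 := by
    rw [norm_pow]
    exact pow_le_one₀ (norm_nonneg q) hq.le
  calc ‖1 - q ^ e‖ ≤ ‖(1 : ℂ)‖ + ‖q ^ e‖ := norm_sub_le _ _
    _ ≤ 2 := by rw [norm_one]; linarith

lemma norm_sign_mul_pow_le {q : ℂ} (hq : ‖q‖ < 1) (i : ℕ) {n e : ℕ} (h : n ≤ e) :
    ‖(-1) ^ i * q ^ e‖ ≤ ‖q‖ ^ n := by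
  rw [norm_mul, norm_pow, norm_pow, norm_neg, norm_one, one_pow, one_mul]
  exact pow_le_pow_of_le_one (norm_nonneg q) hq.le h

lemma exists_norm_pochRatio_le {q : ℂ} (hq : ‖q‖ < 1) :
    ∃ C, 0 ≤ C ∧ ∀ μ n, ‖pochRatio q μ n‖ ≤ C := by
  have hq2 := norm_sq_lt_one hq
  obtain ⟨A, hA⟩ := exists_norm_le_of_tendsto (tendsto_qPoch hq2 (q ^ 2))
  obtain ⟨B, hB⟩ := exists_norm_inv_le_of_tendsto (tendsto_qPoch hq2 (q ^ 2))
    (qPochInf_ne_zero hq2 hq2)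
  have hA0 : 0 ≤ A := (norm_nonneg _).trans (hA 0)
  have hB0 : 0 ≤ B := (norm_nonneg _).trans (hB 0)
  refine ⟨A * B, by positivity, fun μ n => ?_⟩
  rw [pochRatio, div_eq_mul_inv, norm_mul]
  gcongr
  exacts [hA _, hB _]

lemma pochRatio_succ_left (q : ℂ) (μ n : ℕ) :
    pochRatio q (μ + 1) n = (1 - q ^ (2 * (μ + 1 + n))) * pochRatio q μ n := by
  rw [pochRatio, pochRatio, show μ + 1 + n = (μ + n) + 1 by ring, qPoch_succ]
  ring

lemma one_sub_mul_pochRatio_succ {q : ℂ} (hq : ‖q‖ < 1) (μ n : ℕ) :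
    (1 - q ^ (2 * (n + 1))) * pochRatio q μ (n + 1) = pochRatio q (μ + 1) n := by
  have hq2 := norm_sq_lt_one hq
  have h1 := qPoch_ne_zero hq2 hq2 n
  have h2 := one_sub_mul_pow_ne_zero hq2 hq2 n
  rw [pochRatio, pochRatio, show μ + (n + 1) = μ + 1 + n by ring, qPoch_succ,
    show q ^ (2 * (n + 1)) = q ^ 2 * (q ^ 2) ^ n by ring]
  field_simp

lemma summable_mul_pochRatio {q : ℂ} (hq : ‖q‖ < 1) {w : ℕ → ℂ} {B : ℝ}
    (hw : ∀ n, ‖w n‖ ≤ B * ‖q‖ ^ n) (μ : ℕ) : Summable fun n => w n * pochRatio q μ n := by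
  obtain ⟨C, hC0, hC⟩ := exists_norm_pochRatio_le hq
  refine Summable.of_norm_bounded (((summable_geometric_of_lt_one (norm_nonneg q) hq).mul_left
    B).mul_right C) fun n => ?_
  rw [norm_mul]
  exact mul_le_mul (hw n) (hC μ n) (norm_nonneg _) ((norm_nonneg _).trans (hw n))

lemma norm_mul_one_sub_pow_le {q : ℂ} (hq : ‖q‖ < 1) {w : ℂ} {n : ℕ} (hw : ‖w‖ ≤ ‖q‖ ^ n)
    (e : ℕ) : ‖w * (1 - q ^ e)‖ ≤ 2 * ‖q‖ ^ n := by
  rw [norm_mul, mul_comm]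
  exact mul_le_mul (norm_one_sub_pow_le hq e) hw (norm_nonneg _) zero_le_two

lemma summable_gordonTerm {q : ℂ} (hq : ‖q‖ < 1) {k a : ℕ} (hk : 1 ≤ k) (μ : ℕ) :
    Summable (gordonTerm q k μ a) := by
  refine summable_mul_pochRatio hq (B := 2) (fun n => norm_mul_one_sub_pow_le hq
    (norm_sign_mul_pow_le hq n ?_) _) μ
  nlinarith [Nat.zero_le ((2 * k + 2) * n.choose 2), Nat.zero_le (μ * k * n),
    Nat.zero_le ((k + 2 - a) * n)]

lemma tsum_shift_pochRatio {q : ℂ} (hq : ‖q‖ < 1) {v w : ℕ → ℂ}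
    (hv : ∀ n, ‖v n‖ ≤ ‖q‖ ^ n) (hw : ∀ n, ‖w n‖ ≤ ‖q‖ ^ n) (μ : ℕ) :
    ∑' n, (v n * (1 - q ^ (2 * n)) + w n * (1 - q ^ (2 * (μ + 1 + n)))) * pochRatio q μ n =
      ∑' n, (v (n + 1) + w n) * pochRatio q (μ + 1) n := by
  have hX : Summable fun n => v n * (1 - q ^ (2 * n)) * pochRatio q μ n :=
    summable_mul_pochRatio hq (fun n => norm_mul_one_sub_pow_le hq (hv n) _) μ
  have hY : Summable fun n => w n * pochRatio q (μ + 1) n :=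
    summable_mul_pochRatio hq (B := 1) (fun n => by simpa using hw n) (μ + 1)
  have hXs : ∀ n, v (n + 1) * (1 - q ^ (2 * (n + 1))) * pochRatio q μ (n + 1) =
      v (n + 1) * pochRatio q (μ + 1) n := fun n => by
    rw [mul_assoc, one_sub_mul_pochRatio_succ hq]
  have hX' : Summable fun n => v (n + 1) * pochRatio q (μ + 1) n :=
    ((summable_nat_add_iff 1).mpr hX).congr hXs
  calc _ = ∑' n, (v n * (1 - q ^ (2 * n)) * pochRatio q μ n + w n * pochRatio q (μ + 1) n) :=
        tsum_congr fun n => by rw [pochRatio_succ_left]; ring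
    _ = ∑' n, (v (n + 1) * pochRatio q (μ + 1) n + w n * pochRatio q (μ + 1) n) := by
        rw [hX.tsum_add hY, hX'.tsum_add hY, hX.tsum_eq_zero_add]
        simp only [hXs]
        simp
    _ = _ := tsum_congr fun n => by ring

lemma gordonSum_zero (q : ℂ) (k μ : ℕ) : gordonSum q k μ 0 = 0 := by
  simp [gordonSum, gordonTerm]

lemma gordonSum_add_two {q : ℂ} (hq : ‖q‖ < 1) {k a : ℕ} (ha : a + 1 ≤ k) (μ : ℕ) :
    gordonSum q k μ (a + 2) =
      gordonSum q k μ a + q ^ ((μ + 1) * a) * gordonSum q k (μ + 1) (k - a) := by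
  obtain ⟨b, rfl⟩ := Nat.exists_eq_add_of_le ha
  set k := a + 1 + b with hk
  have hs : ∀ a, Summable (gordonTerm q k μ a) := fun a => summable_gordonTerm hq (by omega) μ
  rw [← sub_eq_iff_eq_add']
  unfold gordonSum
  rw [← (hs (a + 2)).tsum_sub (hs a), ← tsum_mul_left]
  set E : ℕ → ℕ := fun n => (2 * k + 2) * n.choose 2 + ((μ + 1) * k + (b + 1)) * n with hE
  have hEn : ∀ n, n ≤ E n := fun n => by
    simp only [hE]
    nlinarith [Nat.zero_le ((2 * k + 2) * n.choose 2), Nat.zero_le ((μ + 1) * k * n),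
      Nat.zero_le (b * n)]
  have key := tsum_shift_pochRatio hq (v := fun n => (-1) ^ n * q ^ E n)
    (w := fun n => (-1) ^ n * q ^ (E n + (2 * n + (μ + 1 + 2 * n) * a)))
    (fun n => norm_sign_mul_pow_le hq n (hEn n))
    (fun n => norm_sign_mul_pow_le hq n ((hEn n).trans (Nat.le_add_right _ _))) μ
  convert key using 1
  · refine tsum_congr fun n => ?_
    rw [gordonTerm, gordonTerm, show k + 2 - (a + 2) = b + 1 by omega,
      show k + 2 - a = b + 3 by omega]
    simp only [hE]
    ring
  · refine tsum_congr fun n => ?_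
    rw [gordonTerm, show k + 2 - (k - a) = a + 2 by omega, show k - a = b + 1 by omega]
    simp only [hE, Nat.choose_succ_succ' n 1, Nat.choose_one_right]
    rw [hk]
    ring

lemma gordonSum_one {q : ℂ} (hq : ‖q‖ < 1) {k : ℕ} (hk : 1 ≤ k) (μ : ℕ) :
    (1 + q ^ (μ + 1)) * gordonSum q k μ 1 = gordonSum q k (μ + 1) (k + 1) := by
  unfold gordonSum
  rw [← tsum_mul_left]
  set E : ℕ → ℕ := fun n => (2 * k + 2) * n.choose 2 + ((μ + 1) * k + (k + 1)) * n with hE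
  have hEn : ∀ n, n ≤ E n := fun n => by
    simp only [hE]
    nlinarith [Nat.zero_le ((2 * k + 2) * n.choose 2), Nat.zero_le ((μ + 1) * k * n),
      Nat.zero_le (k * n)]
  have key := tsum_shift_pochRatio hq (v := fun n => (-1) ^ n * q ^ (E n + (μ + 1)))
    (w := fun n => (-1) ^ n * q ^ E n)
    (fun n => norm_sign_mul_pow_le hq n ((hEn n).trans (Nat.le_add_right _ _)))
    (fun n => norm_sign_mul_pow_le hq n (hEn n)) μ
  convert key using 1
  · refine tsum_congr fun n => ?_
    rw [gordonTerm, show k + 2 - 1 = k + 1 by omega]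
    simp only [hE]
    ring
  · refine tsum_congr fun n => ?_
    rw [gordonTerm, show k + 2 - (k + 1) = 1 by omega]
    simp only [hE, Nat.choose_succ_succ' n 1, Nat.choose_one_right]
    ring

lemma tendsto_gordonSum {q : ℂ} (hq : ‖q‖ < 1) {k a : ℕ} (hk : 1 ≤ k) (ha : 1 ≤ a) :
    Tendsto (fun μ => gordonSum q k μ a) atTop (𝓝 (qPochInf (q ^ 2) (q ^ 2))) := by
  have hq2 := norm_sq_lt_one hq
  obtain ⟨C, hC0, hC⟩ := exists_norm_pochRatio_le hq
  have hexp : ∀ μ n : ℕ, (μ + 1) * n ≤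
      (2 * k + 2) * n.choose 2 + ((μ + 1) * k + (k + 2 - a)) * n := fun μ n =>
    calc (μ + 1) * n ≤ ((μ + 1) * k + (k + 2 - a)) * n :=
          Nat.mul_le_mul_right n (le_add_right (Nat.le_mul_of_pos_right _ hk))
      _ ≤ _ := Nat.le_add_left _ _
  have hbound : ∀ μ n : ℕ, ‖gordonTerm q k μ a n‖ ≤ 2 * ‖q‖ ^ ((μ + 1) * n) * C := fun μ n => by
    rw [gordonTerm, norm_mul]
    exact mul_le_mul (norm_mul_one_sub_pow_le hq (norm_sign_mul_pow_le hq n (hexp μ n)) _)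
      (hC μ n) (norm_nonneg _) (by positivity)
  have hlim : Tendsto (fun μ => gordonSum q k μ a) atTop
      (𝓝 (∑' n : ℕ, if n = 0 then qPochInf (q ^ 2) (q ^ 2) else 0)) := by
    refine tendsto_tsum_of_dominated_convergence (bound := fun n => 2 * ‖q‖ ^ n * C)
      (((summable_geometric_of_lt_one (norm_nonneg q) hq).mul_left 2).mul_right C)
      (fun n => ?_) (Eventually.of_forall fun μ n => (hbound μ n).trans ?_)
    · rcases Nat.eq_zero_or_pos n with rfl | hn
      · have h0 : Tendsto (fun μ : ℕ => q ^ ((μ + 1) * a)) atTop (𝓝 0) :=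
          (tendsto_pow_atTop_nhds_zero_of_norm_lt_one hq).comp
            (tendsto_atTop_mono (fun μ => (Nat.le_succ μ).trans (Nat.le_mul_of_pos_right _ ha))
              tendsto_id)
        have h := (h0.const_sub 1).mul (tendsto_qPoch hq2 (q ^ 2))
        simpa [gordonTerm, pochRatio, qPoch] using h
      · rw [if_neg hn.ne']
        refine squeeze_zero_norm (fun μ => hbound μ n) ?_
        have h0 : Tendsto (fun μ : ℕ => ‖q‖ ^ ((μ + 1) * n)) atTop (𝓝 0) :=
          (tendsto_pow_atTop_nhds_zero_of_lt_one (norm_nonneg q) hq).comp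
            (tendsto_atTop_mono (fun μ => (Nat.le_succ μ).trans (Nat.le_mul_of_pos_right _ hn))
              tendsto_id)
        simpa using (h0.const_mul 2).mul_const C
    · gcongr ?_ * ?_ * ?_
      exact pow_le_pow_of_le_one (norm_nonneg q) hq.le (Nat.le_mul_of_pos_left n μ.succ_pos)
  rwa [tsum_ite_eq] at hlim

/-- Closed form of the generating function of the admissible partitions with smallest part at
least `2 * l + 1` and fewer than `a` parts equal to `2 * l + 1`. -/
noncomputable def oddGenFun (q : ℂ) (k l a : ℕ) : ℂ :=
  qPochInf (q ^ 2) (-(q ^ 2)) / (qPoch (q ^ 2) (-(q ^ 2)) l * qPochInf (q ^ 2) (q ^ 2)) *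
    gordonSum q k (2 * l) (2 * ((a + 1) / 2))

/-- The analogue of `oddGenFun` for an arbitrary smallest allowed part `m`. -/
noncomputable def genFun (q : ℂ) (k m a : ℕ) : ℂ :=
  if Odd m then oddGenFun q k (m / 2) a
  else ∑ j ∈ range a, q ^ (m * j) * oddGenFun q k (m / 2) (k - j)

lemma genFun_even_eq {q : ℂ} (hq : ‖q‖ < 1) {k : ℕ} (hk : Odd k) (l d : ℕ) (hd : 2 * d + 1 ≤ k) :
    genFun q k (2 * l + 2) (2 * d + 1) =
      qPochInf (q ^ 2) (-(q ^ 2)) / (qPoch (q ^ 2) (-(q ^ 2)) l * qPochInf (q ^ 2) (q ^ 2)) *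
        gordonSum q k (2 * l + 1) (2 * d + 1) := by
  have hq2 := norm_sq_lt_one hq
  have hq2' : ‖-(q ^ 2)‖ < 1 := by rwa [norm_neg]
  have hD := qPochInf_ne_zero hq2 hq2
  have hN := qPoch_ne_zero hq2 hq2' l
  have hf : 1 + q ^ (2 * l + 2) ≠ 0 := by
    have h := one_sub_mul_pow_ne_zero hq2 hq2' l
    rwa [show 1 - -(q ^ 2) * (q ^ 2) ^ l = 1 + q ^ (2 * l + 2) by ring] at h
  have hNs : qPoch (q ^ 2) (-(q ^ 2)) (l + 1) =
      qPoch (q ^ 2) (-(q ^ 2)) l * (1 + q ^ (2 * l + 2)) := by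
    rw [qPoch_succ]
    ring
  obtain ⟨κ, hκ⟩ := hk
  rw [genFun, if_neg (by simp [parity_simps]), show (2 * l + 2) / 2 = l + 1 by omega]
  induction d with
  | zero =>
    have h := gordonSum_one hq (show 1 ≤ k by omega) (2 * l + 1)
    rw [show 2 * l + 1 + 1 = 2 * l + 2 by ring] at h
    simp only [mul_zero, zero_add, range_one, sum_singleton, pow_zero, one_mul, Nat.sub_zero]
    rw [oddGenFun, show 2 * ((k + 1) / 2) = k + 1 by omega, show 2 * (l + 1) = 2 * l + 2 by ring,
      ← h, hNs]
    field_simp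
  | succ d ih =>
    have h := gordonSum_add_two hq (show 2 * d + 1 + 1 ≤ k by omega) (2 * l + 1)
    rw [show 2 * (d + 1) + 1 = 2 * d + 1 + 1 + 1 by ring, sum_range_succ, sum_range_succ,
      ih (by omega), show 2 * d + 1 + 1 + 1 = 2 * d + 1 + 2 by ring, h]
    simp only [oddGenFun]
    rw [show 2 * ((k - (2 * d + 1) + 1) / 2) = k - (2 * d + 1) by omega,
      show 2 * ((k - (2 * d + 1 + 1) + 1) / 2) = k - (2 * d + 1) by omega,
      show 2 * (l + 1) = 2 * l + 1 + 1 by ring, hNs]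
    field_simp
    ring

lemma genFun_rec {q : ℂ} (hq : ‖q‖ < 1) {k : ℕ} (hk : Odd k) {m a : ℕ} (hm : 1 ≤ m)
    (hak : a ≤ k) :
    genFun q k m a =
      ∑ j ∈ range a with (Odd m → Even j), q ^ (m * j) * genFun q k (m + 1) (k - j) := by
  rcases Nat.even_or_odd' m with ⟨l, rfl | rfl⟩
  · rw [genFun, if_neg (by simp)]
    have hfilter : (range a).filter (fun j => Odd (2 * l) → Even j) = range a :=
      filter_true_of_mem fun j _ h => absurd h (by simp)
    rw [hfilter]
    refine sum_congr rfl fun j _ => ?_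
    rw [genFun, if_pos (by simp), show (2 * l + 1) / 2 = 2 * l / 2 by omega]
  · rw [genFun, if_pos (by simp), show (2 * l + 1) / 2 = l by omega, sum_filter]
    induction a with
    | zero => simp [oddGenFun, gordonSum_zero]
    | succ a ih =>
      rw [sum_range_succ, ← ih (by omega)]
      obtain ⟨κ, hκ⟩ := hk
      rcases Nat.even_or_odd' a with ⟨d, rfl | rfl⟩
      · rw [if_pos (by simp), show 2 * l + 1 + 1 = 2 * l + 2 by ring,
          show k - 2 * d = 2 * (κ - d) + 1 by omega,
          genFun_even_eq hq ⟨κ, hκ⟩ _ _ (by omega), oddGenFun, oddGenFun,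
          show 2 * ((2 * d + 1 + 1) / 2) = 2 * d + 2 by omega,
          show 2 * ((2 * d + 1) / 2) = 2 * d by omega,
          gordonSum_add_two hq (by omega), show k - 2 * d = 2 * (κ - d) + 1 by omega]
        ring
      · rw [if_neg (by simp [parity_simps]), add_zero, oddGenFun, oddGenFun,
          show 2 * ((2 * d + 1 + 1 + 1) / 2) = 2 * d + 2 by omega,
          show 2 * ((2 * d + 1 + 1) / 2) = 2 * d + 2 by omega]

lemma tendsto_genFun_odd {q : ℂ} (hq : ‖q‖ < 1) {k a : ℕ} (hk : 1 ≤ k) (ha : 1 ≤ a) :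
    Tendsto (fun l => genFun q k (2 * l + 1) a) atTop (𝓝 1) := by
  have hq2 := norm_sq_lt_one hq
  have hq2' : ‖-(q ^ 2)‖ < 1 := by rwa [norm_neg]
  have hD := qPochInf_ne_zero hq2 hq2
  have hN := qPochInf_ne_zero hq2 hq2'
  have h2 : Tendsto (fun N : ℕ => 2 * N) atTop atTop := tendsto_id.const_mul_atTop' two_pos
  have h := ((tendsto_const_nhds (x := qPochInf (q ^ 2) (-(q ^ 2)))).div
    ((tendsto_qPoch hq2 (-(q ^ 2))).mul_const (qPochInf (q ^ 2) (q ^ 2)))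
    (mul_ne_zero hN hD)).mul ((tendsto_gordonSum hq hk
      (show 1 ≤ 2 * ((a + 1) / 2) by omega)).comp h2)
  rw [show qPochInf (q ^ 2) (-(q ^ 2)) / (qPochInf (q ^ 2) (-(q ^ 2)) * qPochInf (q ^ 2) (q ^ 2)) *
    qPochInf (q ^ 2) (q ^ 2) = 1 by field_simp] at h
  refine h.congr fun l => ?_
  rw [genFun, if_pos (by simp), show (2 * l + 1) / 2 = l by omega, oddGenFun]
  rfl

/-- Multisets of parts in `[m, m + N)` with multiplicities `f` satisfying `f m < a`,
`f i + f (i + 1) ≤ k - 1`, and `f i` even for odd `i`. -/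
def admissible (k : ℕ) : ℕ → ℕ → ℕ → Finset (Multiset ℕ)
  | 0, _, _ => {0}
  | N + 1, m, a => ((range a).filter fun j => Odd m → Even j).biUnion fun j =>
      (admissible k N (m + 1) (k - j)).image fun s => Multiset.replicate j m + s

lemma mem_admissible {k : ℕ} (N m a : ℕ) (ha : 1 ≤ a) (hak : a ≤ k) (s : Multiset ℕ) :
    s ∈ admissible k N m a ↔ (∀ i ∈ s, m ≤ i ∧ i < m + N) ∧ s.count m ≤ a - 1 ∧
      (∀ i, m ≤ i → s.count i + s.count (i + 1) ≤ k - 1) ∧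
      ∀ i, m ≤ i → Odd i → Even (s.count i) := by
  induction N generalizing m a s with
  | zero =>
    simp only [admissible, mem_singleton]
    constructor
    · rintro rfl
      simp
    · rintro ⟨h, -⟩
      exact Multiset.eq_zero_of_forall_notMem fun i hi => by have := h i hi; omega
  | succ N ih =>
    simp only [admissible, mem_biUnion, mem_filter, mem_range, mem_image]
    constructor
    · rintro ⟨j, ⟨hj, hpar⟩, t, ht, rfl⟩
      rw [ih (m + 1) (k - j) (by omega) (by omega)] at ht
      obtain ⟨h1, h2, h3, h4⟩ := ht
      have hm : t.count m = 0 :=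
        Multiset.count_eq_zero_of_notMem fun h => by have := h1 m h; omega
      have hcount : ∀ i, m < i → (Multiset.replicate j m + t).count i = t.count i := fun i hi => by
        simp [Multiset.count_replicate, hi.ne]
      have hcm : (Multiset.replicate j m + t).count m = j := by simp [hm]
      refine ⟨fun i hi => ?_, by omega, fun i hi => ?_, fun i hi hodd => ?_⟩
      · rcases Multiset.mem_add.mp hi with hi | hi
        · rw [Multiset.eq_of_mem_replicate hi]
          omega
        · have := h1 i hi
          omega
      · rw [hcount (i + 1) (by omega)]
        rcases hi.eq_or_lt with rfl | hi
        · omega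
        · rw [hcount i hi]
          exact h3 i hi
      · rcases hi.eq_or_lt with rfl | hi
        · rw [hcm]
          exact hpar hodd
        · rw [hcount i hi]
          exact h4 i hi hodd
    · rintro ⟨h1, h2, h3, h4⟩
      have hcount : ∀ i, m < i → (s.filter (· ≠ m)).count i = s.count i := fun i hi =>
        Multiset.count_filter_of_pos hi.ne'
      refine ⟨s.count m, ⟨by omega, h4 m le_rfl⟩, s.filter (· ≠ m), ?_, ?_⟩
      · rw [ih (m + 1) (k - s.count m) (by omega) (by omega)]
        refine ⟨fun i hi => ?_, ?_, fun i hi => ?_, fun i hi => ?_⟩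
        · obtain ⟨hi, hne⟩ := Multiset.mem_filter.mp hi
          have := h1 i hi
          omega
        · rw [hcount _ (by omega)]
          have := h3 m le_rfl
          omega
        · rw [hcount i (by omega), hcount (i + 1) (by omega)]
          exact h3 i (by omega)
        · rw [hcount i (by omega)]
          exact h4 i (by omega)
      · rw [← Multiset.filter_eq' s m]
        exact Multiset.filter_add_not _ s

/-- The generating function of `admissible`. -/
noncomputable def admissibleGenFun (q : ℂ) (k N m a : ℕ) : ℂ :=
  ∑ s ∈ admissible k N m a, q ^ s.sum

lemma admissibleGenFun_succ (q : ℂ) {k : ℕ} (N m a : ℕ) (hak : a ≤ k) :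
    admissibleGenFun q k (N + 1) m a = ∑ j ∈ range a with (Odd m → Even j),
      q ^ (m * j) * admissibleGenFun q k N (m + 1) (k - j) := by
  have hcount : ∀ j < a, ∀ s ∈ admissible k N (m + 1) (k - j),
      (Multiset.replicate j m + s).count m = j := by
    intro j hj s hs
    have h := ((mem_admissible N (m + 1) (k - j) (by omega) (by omega) s).mp hs).1
    have hm : s.count m = 0 := Multiset.count_eq_zero_of_notMem fun hms => by
      have := h m hms
      omega
    simp [hm]
  rw [admissibleGenFun, admissible, sum_biUnion]
  · refine sum_congr rfl fun j _ => ?_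
    rw [sum_image fun s _ t _ h => add_left_cancel h, admissibleGenFun, mul_sum]
    refine sum_congr rfl fun s _ => ?_
    rw [Multiset.sum_add, Multiset.sum_replicate, smul_eq_mul, pow_add, mul_comm j m]
  · intro i hi j hj hij
    rw [Function.onFun, disjoint_left]
    intro s hsi hsj
    simp only [coe_filter, Set.mem_ofPred_eq, mem_range] at hi hj
    obtain ⟨t, ht, rfl⟩ := mem_image.mp hsi
    obtain ⟨u, hu, htu⟩ := mem_image.mp hsj
    apply hij
    rw [← hcount i hi.1 t ht, ← htu, hcount j hj.1 u hu]

lemma norm_genFun_sub_le {q : ℂ} (hq : ‖q‖ < 1) {k : ℕ} (hk : Odd k) {ε : ℝ} (N m a : ℕ)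
    (hm : 1 ≤ m) (ha : 1 ≤ a) (hak : a ≤ k)
    (hε : ∀ b, 1 ≤ b → b ≤ k → ‖genFun q k (m + N) b - 1‖ ≤ ε) :
    ‖genFun q k m a - admissibleGenFun q k N m a‖ ≤
      Real.exp (k * ‖q‖ ^ m / (1 - ‖q‖)) * ε := by
  have hε0 : 0 ≤ ε := (norm_nonneg _).trans (hε a ha hak)
  have hq1 : 0 < 1 - ‖q‖ := by linarith
  induction N generalizing m a with
  | zero =>
    have h := hε a ha hak
    simp only [admissibleGenFun, admissible, sum_singleton, Multiset.sum_zero, pow_zero]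
    refine h.trans (le_mul_of_one_le_left hε0 (Real.one_le_exp (by positivity)))
  | succ N ih =>
    rw [genFun_rec hq hk hm hak, admissibleGenFun_succ q N m a hak, ← sum_sub_distrib]
    set B := Real.exp (k * ‖q‖ ^ (m + 1) / (1 - ‖q‖)) * ε with hB
    have hB0 : 0 ≤ B := by positivity
    have hterm : ∀ j ∈ (range a).filter (fun j => Odd m → Even j),
        ‖q ^ (m * j) * genFun q k (m + 1) (k - j) -
          q ^ (m * j) * admissibleGenFun q k N (m + 1) (k - j)‖ ≤ ‖q‖ ^ (m * j) * B := by
      intro j hj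
      have hj' : j < a := mem_range.mp (mem_filter.mp hj).1
      rw [← mul_sub, norm_mul, norm_pow]
      gcongr
      refine ih (m + 1) (k - j) (by omega) (by omega) (by omega) fun b hb hbk => ?_
      rw [show m + 1 + N = m + (N + 1) by ring]
      exact hε b hb hbk
    have hsum : ∑ j ∈ range a, ‖q‖ ^ (m * j) ≤ 1 + k * ‖q‖ ^ m := by
      obtain ⟨c, rfl⟩ := Nat.exists_eq_add_of_le' ha
      rw [sum_range_succ', mul_zero, pow_zero, add_comm]
      gcongr
      calc ∑ j ∈ range c, ‖q‖ ^ (m * (j + 1)) ≤ ∑ _j ∈ range c, ‖q‖ ^ m :=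
            sum_le_sum fun j _ => pow_le_pow_of_le_one (norm_nonneg q) hq.le
              (Nat.le_mul_of_pos_right m j.succ_pos)
        _ = c * ‖q‖ ^ m := by simp
        _ ≤ k * ‖q‖ ^ m := by
            gcongr
            omega
    calc _ ≤ ∑ j ∈ range a with (Odd m → Even j), ‖q‖ ^ (m * j) * B := norm_sum_le_of_le _ hterm
      _ ≤ ∑ j ∈ range a, ‖q‖ ^ (m * j) * B :=
          sum_le_sum_of_subset_of_nonneg (filter_subset _ _) fun j _ _ => by positivity
      _ = (∑ j ∈ range a, ‖q‖ ^ (m * j)) * B := by rw [sum_mul]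
      _ ≤ (1 + k * ‖q‖ ^ m) * B := by gcongr
      _ ≤ Real.exp (k * ‖q‖ ^ m) * B := by
          gcongr
          rw [add_comm]
          exact Real.add_one_le_exp _
      _ = _ := by
          rw [hB, ← mul_assoc, ← Real.exp_add]
          congr 2
          field_simp
          ring

lemma tendsto_admissibleGenFun {q : ℂ} (hq : ‖q‖ < 1) {k a : ℕ} (hk : Odd k) (ha : 1 ≤ a)
    (hak : a ≤ k) :
    Tendsto (fun l => admissibleGenFun q k (2 * l) 1 a) atTop (𝓝 (genFun q k 1 a)) := by
  set S : ℕ → ℝ := fun l => ∑ b ∈ Icc 1 k, ‖genFun q k (2 * l + 1) b - 1‖ with hS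
  have hS0 : Tendsto S atTop (𝓝 0) := by
    rw [← sum_const_zero (s := Icc 1 k)]
    refine tendsto_finsetSum _ fun b hb => ?_
    have h := tendsto_genFun_odd hq hk.pos (mem_Icc.mp hb).1
    simpa using (h.sub_const 1).norm
  rw [tendsto_iff_norm_sub_tendsto_zero]
  refine squeeze_zero (fun _ => norm_nonneg _) (fun l => ?_)
    (by simpa using hS0.const_mul (Real.exp (k * ‖q‖ ^ 1 / (1 - ‖q‖))))
  rw [norm_sub_rev]
  refine norm_genFun_sub_le hq hk (2 * l) 1 a le_rfl ha hak fun b hb hbk => ?_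
  rw [add_comm 1 (2 * l)]
  exact single_le_sum (f := fun b => ‖genFun q k (2 * l + 1) b - 1‖)
    (fun _ _ => norm_nonneg _) (mem_Icc.mpr ⟨hb, hbk⟩)

lemma gordonSum_zero_left {q : ℂ} (hq : ‖q‖ < 1) {k a : ℕ} (ha : 1 ≤ a) (hak : a ≤ k) :
    gordonSum q k 0 a = qPochInf (q ^ (2 * k + 2)) (q ^ a) *
      qPochInf (q ^ (2 * k + 2)) (q ^ (2 * k + 2 - a)) *
      qPochInf (q ^ (2 * k + 2)) (q ^ (2 * k + 2)) := by
  have hq2 := norm_sq_lt_one hq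
  have hterm : ∀ n, gordonTerm q k 0 a n = (-1) ^ n * (q ^ (2 * k + 2)) ^ n.choose 2 *
      (q ^ (2 * k + 2 - a)) ^ n * (1 - (q ^ a) ^ (2 * n + 1)) := fun n => by
    rw [gordonTerm, pochRatio, zero_add n, div_self (qPoch_ne_zero hq2 hq2 n), mul_one,
      show (0 + 1) * k + (k + 2 - a) = 2 * k + 2 - a by omega]
    ring
  have hpow : ∀ e : ℕ, 1 ≤ e → ‖q ^ e‖ < 1 := fun e he => by
    rw [norm_pow]
    exact pow_lt_one₀ (norm_nonneg q) hq (by omega)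
  rw [gordonSum, tsum_congr hterm]
  refine HasSum.tsum_eq ?_
  by_cases hq0 : q = 0
  · have ha0 : a ≠ 0 := by omega
    have hb0 : 2 * k + 2 - a ≠ 0 := by omega
    have h : HasSum (fun n : ℕ => if n = 0 then (1 : ℂ) else 0) 1 := hasSum_ite_eq 0 1
    simp only [hq0, ne_eq, ha0, hb0, Nat.add_eq_zero_iff, two_ne_zero, and_false,
      not_false_eq_true, zero_pow, qPochInf, zero_mul, sub_zero, tprod_one, mul_one]
    refine h.congr_fun fun n => ?_
    rcases n with _ | n <;> simp
  · refine hasSum_jacobi_triple_product ?_ (pow_ne_zero _ hq0) (hpow a ha) (hpow _ (by omega))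
    rw [← pow_add, Nat.add_sub_cancel' (by omega)]

lemma genFun_one {q : ℂ} (hq : ‖q‖ < 1) {k a : ℕ} (ha : 1 ≤ a) (hak : a ≤ k) (haeven : Even a) :
    genFun q k 1 a =
      qPochInf (q ^ 2) (-(q ^ 2)) * qPochInf (q ^ (2 * k + 2)) (q ^ a) *
        qPochInf (q ^ (2 * k + 2)) (q ^ (2 * k + 2 - a)) *
        qPochInf (q ^ (2 * k + 2)) (q ^ (2 * k + 2)) / qPochInf (q ^ 2) (q ^ 2) := by
  obtain ⟨d, hd⟩ := haeven
  rw [genFun, if_pos odd_one, show 1 / 2 = 0 by norm_num, oddGenFun,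
    show 2 * ((a + 1) / 2) = a by omega, mul_zero, gordonSum_zero_left hq ha hak]
  simp only [qPoch, range_zero, prod_empty, one_mul]
  ring

/-- The partitions counted by `OW_{k,a}(n)`. -/
abbrev OWPartition (k a n : ℕ) : Type :=
  {P : n.Partition //
    P.parts.count 1 ≤ a - 1 ∧
    (∀ i : ℕ, 1 ≤ i → P.parts.count i + P.parts.count (i + 1) ≤ k - 1) ∧
    ∀ j : ℕ, 1 ≤ j → Even (P.parts.count (2 * j - 1))}

/-- The partition whose parts form an admissible multiset of sum `n`. -/
def owPartitionOfAdmissible {k a : ℕ} (ha : 1 ≤ a) (hak : a ≤ k) (N n : ℕ)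
    (s : {s // s ∈ (admissible k N 1 a).filter fun s => s.sum = n}) : OWPartition k a n :=
  have h := (mem_admissible N 1 a ha hak s.1).mp (mem_filter.mp s.2).1
  ⟨⟨s.1, fun hi => (h.1 _ hi).1, (mem_filter.mp s.2).2⟩, h.2.1, h.2.2.1,
    fun j hj => h.2.2.2 _ (by omega) ⟨j - 1, by omega⟩⟩

lemma owPartitionOfAdmissible_injective {k a : ℕ} (ha : 1 ≤ a) (hak : a ≤ k) (N n : ℕ) :
    Function.Injective (owPartitionOfAdmissible ha hak N n) := fun _ _ h =>
  Subtype.ext (congrArg (fun P : OWPartition k a n => P.1.parts) h)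

lemma owPartitionOfAdmissible_surjective {k a : ℕ} (ha : 1 ≤ a) (hak : a ≤ k) {N n : ℕ}
    (hn : n ≤ N) : Function.Surjective (owPartitionOfAdmissible ha hak N n) := by
  rintro ⟨P, h1, h2, h3⟩
  refine ⟨⟨P.parts, mem_filter.mpr ⟨(mem_admissible N 1 a ha hak _).mpr
    ⟨fun i hi => ⟨P.parts_pos hi, ?_⟩, h1, h2, ?_⟩, P.parts_sum⟩⟩, rfl⟩
  · have := P.parts_sum ▸ Multiset.le_sum_of_mem hi
    omega
  · rintro i hi ⟨j, rfl⟩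
    exact h3 (j + 1) (by omega)

lemma card_filter_admissible_le {k a : ℕ} (ha : 1 ≤ a) (hak : a ≤ k) (N n : ℕ) :
    #{s ∈ admissible k N 1 a | s.sum = n} ≤ Nat.card (OWPartition k a n) := by
  rw [← Nat.card_eq_finsetCard]
  exact Nat.card_le_card_of_injective _ (owPartitionOfAdmissible_injective ha hak N n)

lemma card_filter_admissible_eq {k a : ℕ} (ha : 1 ≤ a) (hak : a ≤ k) {N n : ℕ} (hn : n ≤ N) :
    #{s ∈ admissible k N 1 a | s.sum = n} = Nat.card (OWPartition k a n) := by
  rw [← Nat.card_eq_finsetCard]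
  exact Nat.card_eq_of_bijective _ ⟨owPartitionOfAdmissible_injective ha hak N n,
    owPartitionOfAdmissible_surjective ha hak hn⟩

lemma tsum_card_filter_admissible (q : ℂ) (k N a : ℕ) :
    ∑' n, (#{s ∈ admissible k N 1 a | s.sum = n} : ℂ) * q ^ n = admissibleGenFun q k N 1 a := by
  rw [tsum_eq_sum (s := (admissible k N 1 a).image Multiset.sum), admissibleGenFun,
    ← sum_fiberwise_of_maps_to (g := Multiset.sum) fun s hs => mem_image_of_mem _ hs]
  · refine sum_congr rfl fun n _ => ?_
    rw [sum_congr rfl fun s hs => by rw [(mem_filter.mp hs).2], sum_const, nsmul_eq_mul]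
  · intro n hn
    rw [filter_eq_empty_iff.mpr fun s hs h => hn (mem_image.mpr ⟨s, hs, h⟩)]
    simp

lemma summable_card_owPartition {r : ℝ} (hr0 : 0 ≤ r) (hr : r < 1) {k a : ℕ} (hk : Odd k)
    (ha : 1 ≤ a) (hak : a ≤ k) :
    Summable fun n => (Nat.card (OWPartition k a n) : ℝ) * r ^ n := by
  have hr' : ‖(r : ℂ)‖ < 1 := by rwa [Complex.norm_real, Real.norm_of_nonneg hr0]
  obtain ⟨C, hC⟩ := exists_norm_le_of_tendsto (tendsto_admissibleGenFun hr' hk ha hak)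
  refine summable_of_sum_range_le (c := C) (fun n => by positivity) fun M => ?_
  calc ∑ n ∈ range M, (Nat.card (OWPartition k a n) : ℝ) * r ^ n
      = ∑ n ∈ range M, ∑ s ∈ admissible k (2 * M) 1 a with s.sum = n, r ^ s.sum := by
        refine sum_congr rfl fun n hn => ?_
        have hn' := mem_range.mp hn
        rw [← card_filter_admissible_eq ha hak (show n ≤ 2 * M by omega),
          sum_congr rfl fun s hs => by rw [(mem_filter.mp hs).2], sum_const, nsmul_eq_mul]
    _ ≤ ∑ s ∈ admissible k (2 * M) 1 a, r ^ s.sum := by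
        rw [sum_fiberwise_eq_sum_filter]
        exact sum_le_sum_of_subset_of_nonneg (filter_subset _ _) fun s _ _ => by positivity
    _ = ‖admissibleGenFun r k (2 * M) 1 a‖ := by
        rw [admissibleGenFun]
        norm_cast
        rw [Real.norm_of_nonneg (sum_nonneg fun s _ => by positivity)]
    _ ≤ C := hC M

/-- Andrews' theorem: generating function for `\overline{W}_{k,a}(n)` when `k` is odd
and `a` is even. -/
theorem andrews_OW_k_odd_a_even (k a : ℕ) (ha : 1 ≤ a) (hak : a ≤ k)
    (hk : Odd k) (haeven : Even a) (q : ℂ) (hq : ‖q‖ < 1) :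
    Summable (fun n : ℕ =>
      (Nat.card {P : n.Partition //
          P.parts.count 1 ≤ a - 1 ∧
          (∀ i : ℕ, 1 ≤ i → P.parts.count i + P.parts.count (i + 1) ≤ k - 1) ∧
          ∀ j : ℕ, 1 ≤ j → Even (P.parts.count (2 * j - 1))} : ℂ) * q ^ n) ∧
    ∑' n : ℕ,
      (Nat.card {P : n.Partition //
          P.parts.count 1 ≤ a - 1 ∧
          (∀ i : ℕ, 1 ≤ i → P.parts.count i + P.parts.count (i + 1) ≤ k - 1) ∧
          ∀ j : ℕ, 1 ≤ j → Even (P.parts.count (2 * j - 1))} : ℂ) * q ^ n =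
      qPochInf (q ^ 2) (-(q ^ 2)) * qPochInf (q ^ (2 * k + 2)) (q ^ a) *
        qPochInf (q ^ (2 * k + 2)) (q ^ (2 * k + 2 - a)) *
        qPochInf (q ^ (2 * k + 2)) (q ^ (2 * k + 2)) / qPochInf (q ^ 2) (q ^ 2) := by
  have hbound := summable_card_owPartition (norm_nonneg q) hq hk ha hak
  refine ⟨Summable.of_norm (by simpa using hbound), ?_⟩
  rw [← genFun_one hq ha hak haeven]
  have hlim : Tendsto (fun l => ∑' n, (#{s ∈ admissible k (2 * l) 1 a | s.sum = n} : ℂ) * q ^ n)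
      atTop (𝓝 (∑' n, (Nat.card (OWPartition k a n) : ℂ) * q ^ n)) := by
    refine tendsto_tsum_of_dominated_convergence hbound (fun n => ?_)
      (Eventually.of_forall fun l n => ?_)
    · refine tendsto_const_nhds.congr' ?_
      filter_upwards [eventually_ge_atTop n] with l hl
      rw [card_filter_admissible_eq ha hak (by omega)]
    · rw [norm_mul, norm_pow, Complex.norm_natCast]
      gcongr
      exact card_filter_admissible_le ha hak _ _
  simp only [tsum_card_filter_admissible] at hlim
  exact tendsto_nhds_unique hlim (tendsto_admissibleGenFun hq hk ha hak)
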